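/- If φ, ψ ∈ H¹(ℝ³) are real-valued solutions of the elliptic system Δφ − φ + (φ² + βψ²)φ = 0, Δψ − ψ + (ψ² + βφ²)ψ = 0, then the Pohozaev-type identities K(φ,ψ) = 3 M(φ,ψ) and P(φ,ψ) = 4 M(φ,ψ) hold. -/

import Mathlib

open MeasureTheory

noncomputable section

abbrev E3 : Type := EuclideanSpace ℝ (Fin 3)

/-- Laplacian of a real-valued function on ℝ³. -/
def lapR (f : E3 → ℝ) (x : E3) : ℝ :=
  ∑ i : Fin 3, fderiv ℝ (fun y => fderiv ℝ f y (EuclideanSpace.single i 1)) x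
    (EuclideanSpace.single i 1)

/-- `|∇f|²`. -/
def gradSqR (f : E3 → ℝ) (x : E3) : ℝ :=
  ∑ i : Fin 3, (fderiv ℝ f x (EuclideanSpace.single i 1)) ^ 2

/-- Mass `M(f,g) = ∫ (f² + g²)`. -/
def Mfun (f g : E3 → ℝ) : ℝ := ∫ x, (f x ^ 2 + g x ^ 2)

/-- Kinetic energy `K(f,g) = ∫ (|∇f|² + |∇g|²)`. -/
def Kfun (f g : E3 → ℝ) : ℝ := ∫ x, (gradSqR f x + gradSqR g x)

/-- `P(f,g) = ∫ (f⁴ + 2β f²g² + g⁴)`. -/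
def Pfun (β : ℝ) (f g : E3 → ℝ) : ℝ :=
  ∫ x, (f x ^ 4 + 2 * β * f x ^ 2 * g x ^ 2 + g x ^ 4)

open LineDeriv

/-- Coordinate direction. -/
abbrev ee (i : Fin 3) : E3 := EuclideanSpace.single i 1

/-- `f` is Schwartz and `f'` is its derivative in direction `ee i`. -/
def HD (i : Fin 3) (f f' : E3 → ℝ) : Prop :=
  (∃ s : SchwartzMap E3 ℝ, ∀ x, s x = f x) ∧ ∀ x, HasLineDerivAt ℝ f (f' x) x (ee i)

lemma HD.of (i : Fin 3) (s : SchwartzMap E3 ℝ) : HD i (fun x => s x) (fun x => ∂_{ee i} s x) :=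
  ⟨⟨s, fun _ => rfl⟩, fun x => (s.hasFDerivAt x).hasLineDerivAt (ee i)⟩

lemma HD.add {i : Fin 3} {f f' g g' : E3 → ℝ} (hf : HD i f f') (hg : HD i g g') :
    HD i (fun x => f x + g x) (fun x => f' x + g' x) := by
  obtain ⟨⟨s, hs⟩, h1⟩ := hf
  obtain ⟨⟨t, ht⟩, h2⟩ := hg
  refine ⟨⟨s + t, fun x => by simp [hs, ht]⟩, fun x => ?_⟩
  exact HasDerivAt.add (h1 x) (h2 x)

lemma HD.const_mul {i : Fin 3} {f f' : E3 → ℝ} (c : ℝ) (hf : HD i f f') :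
    HD i (fun x => c * f x) (fun x => c * f' x) := by
  obtain ⟨⟨s, hs⟩, h1⟩ := hf
  refine ⟨⟨c • s, fun x => by simp [hs]⟩, fun x => ?_⟩
  exact HasDerivAt.const_mul c (h1 x)

lemma HD.mul {i : Fin 3} {f f' g g' : E3 → ℝ} (hf : HD i f f') (hg : HD i g g') :
    HD i (fun x => f x * g x) (fun x => f' x * g x + f x * g' x) := by
  obtain ⟨⟨s, hs⟩, h1⟩ := hf
  obtain ⟨⟨t, ht⟩, h2⟩ := hg
  refine ⟨⟨SchwartzMap.smulLeftCLM ℝ (s : E3 → ℝ) t, fun x => ?_⟩, fun x => ?_⟩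
  · rw [SchwartzMap.smulLeftCLM_apply_apply s.hasTemperateGrowth]; simp [hs, ht]
  · have := HasDerivAt.mul (h1 x) (h2 x)
    simp only [zero_smul, add_zero] at this
    exact this

lemma coord_tg (j : Fin 3) : Function.HasTemperateGrowth (fun x : E3 => x j) :=
  (EuclideanSpace.proj j : E3 →L[ℝ] ℝ).hasTemperateGrowth

lemma HD.coord {i : Fin 3} {f f' : E3 → ℝ} (j : Fin 3) (hf : HD i f f') :
    HD i (fun x => x j * f x) (fun x => (if j = i then 1 else 0) * f x + x j * f' x) := by
  obtain ⟨⟨s, hs⟩, h1⟩ := hf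
  refine ⟨⟨SchwartzMap.smulLeftCLM ℝ (fun x : E3 => x j) s, fun x => ?_⟩, fun x => ?_⟩
  · rw [SchwartzMap.smulLeftCLM_apply_apply (coord_tg j)]; simp [hs]
  · have h0 : HasLineDerivAt ℝ (fun x : E3 => x j) (if j = i then 1 else 0) x (ee i) := by
      have := ((EuclideanSpace.proj j : E3 →L[ℝ] ℝ).hasFDerivAt
        (x := x)).hasLineDerivAt (ee i)
      simpa [ee, Pi.single_apply] using! this
    have := HasDerivAt.mul h0 (h1 x)
    simp only [zero_smul, add_zero] at this
    exact this

lemma HD.int {i : Fin 3} {f f' : E3 → ℝ} (hf : HD i f f') :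
    Integrable f' ∧ ∫ x, f' x = 0 := by
  obtain ⟨⟨s, hs⟩, h1⟩ := hf
  obtain rfl : (s : E3 → ℝ) = f := funext hs
  obtain rfl : (fun x => ∂_{ee i} s x) = f' := funext fun x =>
    ((s.hasFDerivAt x).hasLineDerivAt (ee i)).unique (h1 x)
  refine ⟨(∂_{ee i} s).integrable, ?_⟩
  have := integral_mul_fderiv_eq_neg_fderiv_mul_of_integrable (μ := (volume : Measure E3))
    (f := fun _ : E3 => (1 : ℝ)) (g := s) (v := ee i) (by simp)
    (by simpa using (∂_{ee i} s).integrable) (by simpa using s.integrable)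
    (fun _ _ => by fun_prop) (fun x _ => s.differentiableAt)
  change ∫ x, fderiv ℝ s x (ee i) = 0
  simpa using this

lemma HD.int3 {f f' : Fin 3 → E3 → ℝ} (hf : ∀ i, HD i (f i) (f' i)) :
    Integrable (fun x => ∑ i, f' i x) ∧ ∫ x, ∑ i, f' i x = 0 := by
  refine ⟨integrable_finsetSum _ fun i _ => (hf i).int.1, ?_⟩
  rw [integral_finsetSum _ fun i _ => (hf i).int.1]
  exact Finset.sum_eq_zero fun i _ => (hf i).int.2

lemma mul_int (s t : SchwartzMap E3 ℝ) : Integrable (fun x => s x * t x) := by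
  obtain ⟨⟨u, hu⟩, -⟩ := (HD.of 0 s).mul (HD.of 0 t)
  exact u.integrable.congr (.of_forall hu)

lemma mul4_int (s t u v : SchwartzMap E3 ℝ) :
    Integrable (fun x => (s x * t x) * (u x * v x)) := by
  obtain ⟨⟨w, hw⟩, -⟩ := ((HD.of 0 s).mul (HD.of 0 t)).mul ((HD.of 0 u).mul (HD.of 0 v))
  exact w.integrable.congr (.of_forall hw)

lemma symm2 (s : SchwartzMap E3 ℝ) (i j : Fin 3) (x : E3) :
    ∂_{ee i} (∂_{ee j} s) x = ∂_{ee j} (∂_{ee i} s) x := by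
  have h := (s.smooth 2).contDiffAt (x := x)
  have hs : IsSymmSndFDerivAt ℝ s x := h.isSymmSndFDerivAt (by simp)
  have hd : DifferentiableAt ℝ (fderiv ℝ s) x :=
    (SchwartzMap.fderivCLM ℝ E3 ℝ s).differentiableAt
  have key : ∀ a b : E3, ∂_{a} (∂_{b} s) x = fderiv ℝ (fderiv ℝ s) x a b := by
    intro a b
    change fderiv ℝ (fun y => fderiv ℝ s y b) x a = _
    rw [fderiv_clm_apply hd (by fun_prop)]
    simp
  rw [key, key]
  exact hs _ _

lemma lapR_eq (s : SchwartzMap E3 ℝ) (x : E3) : lapR s x = ∑ i, ∂_{ee i} (∂_{ee i} s) x := rfl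

lemma gradSqR_eq (s : SchwartzMap E3 ℝ) (x : E3) : gradSqR s x = ∑ i, (∂_{ee i} s x) ^ 2 := rfl

lemma int_congr {F G : E3 → ℝ} (hFG : ∀ x, G x = F x)
    (hF : Integrable F ∧ ∫ x, F x = 0) : Integrable G ∧ ∫ x, G x = 0 := by
  obtain rfl : G = F := funext hFG
  exact hF

lemma nehari (s : SchwartzMap E3 ℝ) :
    Integrable (fun x => gradSqR s x + s x * lapR s x) ∧
    ∫ x, (gradSqR s x + s x * lapR s x) = 0 := by
  have h := HD.int3 fun i => (HD.of i s).mul (HD.of i (∂_{ee i} s))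
  refine int_congr (fun x => ?_) h
  simp only [gradSqR_eq, lapR_eq, Fin.sum_univ_three]; ring

lemma pohoz (s : SchwartzMap E3 ℝ) :
    Integrable (fun x => lapR s x * (∑ j, x j * ∂_{ee j} s x) - gradSqR s x / 2) ∧
    ∫ x, (lapR s x * (∑ j, x j * ∂_{ee j} s x) - gradSqR s x / 2) = 0 := by
  have t : ∀ i j, HD i _ _ := fun i j =>
    ((HD.of i (∂_{ee j} s)).mul (HD.of i (∂_{ee i} s))).coord j
  have u : ∀ i j, HD i _ _ := fun i j =>
    (((HD.of i (∂_{ee j} s)).mul (HD.of i (∂_{ee j} s))).coord i).const_mul (-1 / 2)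
  have h := HD.int3 fun i =>
    ((((((t i 0).add (t i 1)).add (t i 2)).add (u i 0)).add (u i 1)).add (u i 2))
  refine int_congr (fun x => ?_) h
  have s01 := symm2 s 0 1 x
  have s02 := symm2 s 0 2 x
  have s12 := symm2 s 1 2 x
  simp only [gradSqR_eq, lapR_eq, Fin.sum_univ_three]
  simp
  rw [s01, s02, s12]
  ring

lemma potl (β : ℝ) (s t : SchwartzMap E3 ℝ) :
    ∃ H : E3 → ℝ, (Integrable H ∧ ∫ x, H x = 0) ∧ ∀ x, H x =
      3 * ((s x ^ 2 + t x ^ 2) / 2 - (s x ^ 4 + 2 * β * s x ^ 2 * t x ^ 2 + t x ^ 4) / 4) +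
      ((s x - (s x ^ 2 + β * t x ^ 2) * s x) * (∑ j, x j * ∂_{ee j} s x) +
       (t x - (t x ^ 2 + β * s x ^ 2) * t x) * (∑ j, x j * ∂_{ee j} t x)) := by
  have ss : ∀ i, HD i _ _ := fun i => (HD.of i s).mul (HD.of i s)
  have tt : ∀ i, HD i _ _ := fun i => (HD.of i t).mul (HD.of i t)
  have h := HD.int3 fun i =>
    (((((((ss i).add (tt i)).const_mul (1/2)).add (((ss i).mul (ss i)).const_mul (-1/4))).add
      (((ss i).mul (tt i)).const_mul (-β/2))).add (((tt i).mul (tt i)).const_mul (-1/4))).coord i)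
  refine ⟨_, h, fun x => ?_⟩
  simp only [Fin.sum_univ_three]
  simp
  ring

/-- Pohozaev-type identities `K(φ,ψ) = 3M(φ,ψ)` and `P(φ,ψ) = 4M(φ,ψ)`
for (smooth, rapidly decaying) real solutions of the elliptic system
`Δφ − φ + (φ²+βψ²)φ = 0`, `Δψ − ψ + (ψ²+βφ²)ψ = 0`. -/
theorem pohozaev_identities (β : ℝ) (hβ : 0 < β) (φ ψ : SchwartzMap E3 ℝ)
    (heq1 : ∀ x, lapR (⇑φ) x - φ x + (φ x ^ 2 + β * ψ x ^ 2) * φ x = 0)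
    (heq2 : ∀ x, lapR (⇑ψ) x - ψ x + (ψ x ^ 2 + β * φ x ^ 2) * ψ x = 0) :
    Kfun (⇑φ) (⇑ψ) = 3 * Mfun (⇑φ) (⇑ψ) ∧ Pfun β (⇑φ) (⇑ψ) = 4 * Mfun (⇑φ) (⇑ψ) := by
  have g2 : ∀ s : SchwartzMap E3 ℝ, Integrable (fun x => gradSqR s x) := by
    intro s
    simp only [gradSqR_eq, pow_two]
    exact integrable_finsetSum _ fun i _ => mul_int _ _
  have m2 : Integrable (fun x => φ x ^ 2 + ψ x ^ 2) := by
    simp only [pow_two]; exact (mul_int _ _).add (mul_int _ _)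
  have p4 : Integrable (fun x => φ x ^ 4 + 2 * β * φ x ^ 2 * ψ x ^ 2 + ψ x ^ 4) := by
    refine (((mul4_int φ φ φ φ).add ((mul4_int φ φ ψ ψ).const_mul (2 * β))).add
      (mul4_int ψ ψ ψ ψ)).congr (.of_forall fun x => ?_)
    simp only [Pi.add_apply]; ring
  have k2 : Integrable (fun x => gradSqR φ x + gradSqR ψ x) := (g2 φ).add (g2 ψ)
  have N : Kfun φ ψ + Mfun φ ψ - Pfun β φ ψ = 0 := by
    have h1 := nehari φ
    have h2 := nehari ψ
    have h3 := integral_add h1.1 h2.1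
    rw [h1.2, h2.2, add_zero] at h3
    rw [← h3]
    unfold Kfun Mfun Pfun
    have km : Integrable (fun x => (gradSqR φ x + gradSqR ψ x) + (φ x ^ 2 + ψ x ^ 2)) :=
      k2.add m2
    rw [← integral_add k2 m2, ← integral_sub km p4]
    congr 1; ext x
    linear_combination -φ x * heq1 x - ψ x * heq2 x
  have Q : (-1/2) * Kfun φ ψ - (3/2) * Mfun φ ψ + (3/4) * Pfun β φ ψ = 0 := by
    obtain ⟨H, ⟨hH1, hH2⟩, hH⟩ := potl β φ ψ
    have h1 := pohoz φ
    have h2 := pohoz ψ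
    have h3 := integral_sub (h1.1.add h2.1) hH1
    have h4 := integral_add h1.1 h2.1
    simp only [Pi.add_apply] at h3
    rw [h4, h1.2, h2.2, hH2, add_zero, sub_zero] at h3
    rw [← h3]
    unfold Kfun Mfun Pfun
    have km : Integrable (fun x => (-1/2) * (gradSqR φ x + gradSqR ψ x) -
        (3/2) * (φ x ^ 2 + ψ x ^ 2)) := (k2.const_mul _).sub (m2.const_mul _)
    rw [← integral_const_mul, ← integral_const_mul, ← integral_const_mul,
      ← integral_sub (k2.const_mul _) (m2.const_mul _),
      ← integral_add km (p4.const_mul _)]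
    congr 1; ext x
    simp only [hH]
    linear_combination -(∑ j, x j * ∂_{ee j} φ x) * heq1 x - (∑ j, x j * ∂_{ee j} ψ x) * heq2 x
  constructor <;> linarith
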